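/- arXiv:1707.00775 — 2 statements merged into one kernel-verified Lean document; each statement's English description precedes it below -/
import Mathlib

section
/- (Proposition 2, x-part.) In the travelling-wave Bäcklund setup with b'(α) = (λ w' + sin w)/(λ w' − sin w), K ∈ ℝ, B(α,β) = c(β + b(α) + K), δ = f/(ak²) + (c/(ak)) tanh B, and g = 4c²k³a(1 − tanh² B)/(k⁴a² + f² + 2ckf tanh B + c²k² tanh² B), define x(α,β) := [ 8c²kf cosh 2B + 4c(f² + k⁴a² + c²k²) sinh 2B ] / [ (f² + k⁴a² + c²k²) cosh 2B + 2ckf sinh 2B + f² + k⁴a² − c²k² ], assuming all denominators are nonvanishing. Then x satisfies x_α = g · [ 2δ(λ² + k cos w) + k(δ² − 1) sin w ] / (2kλ(δ² + 1)) and x_β = g · [ 2δ(λ² − k cos w) − k(δ² − 1) sin w ] / (2kλ(δ² + 1)), where w is evaluated at α. -/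
/-- First partial derivative (w.r.t. the first variable) of a curried function of two
real variables. -/
noncomputable def pd1 (f : ℝ → ℝ → ℝ) (x y : ℝ) : ℝ := deriv (fun x' => f x' y) x

/-- Second partial derivative (w.r.t. the second variable). -/
noncomputable def pd2 (f : ℝ → ℝ → ℝ) (x y : ℝ) : ℝ := deriv (fun y' => f x y') y

theorem Real.hasDerivAt_tanh (y : ℝ) :
    HasDerivAt Real.tanh (1 - Real.tanh y ^ 2) y := by
  have hcosh := (Real.cosh_pos y).ne'
  have h := (Real.hasDerivAt_sinh y).div (Real.hasDerivAt_cosh y) hcosh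
  have heq : Real.tanh = Real.sinh / Real.cosh := by
    funext z
    simp [Real.tanh_eq_sinh_div_cosh]
  rw [heq]
  refine h.congr_deriv ?_
  simp only [Pi.div_apply]
  field_simp

/-- The hyperbolic quotient defining the potential, written in terms of `tanh`. -/
theorem potential_eq_tanh (k c a f y : ℝ)
    (hG : k ^ 4 * a ^ 2 + (f + c * k * Real.tanh y) ^ 2 ≠ 0) :
    (8 * c ^ 2 * k * f * Real.cosh (2 * y)
        + 4 * c * (f ^ 2 + k ^ 4 * a ^ 2 + c ^ 2 * k ^ 2) * Real.sinh (2 * y))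
      / ((f ^ 2 + k ^ 4 * a ^ 2 + c ^ 2 * k ^ 2) * Real.cosh (2 * y)
          + 2 * c * k * f * Real.sinh (2 * y) + f ^ 2 + k ^ 4 * a ^ 2 - c ^ 2 * k ^ 2)
      = 4 * c * Real.tanh y
        + 4 * c ^ 2 * k * (1 - Real.tanh y ^ 2) * (f + c * k * Real.tanh y)
          / (k ^ 4 * a ^ 2 + (f + c * k * Real.tanh y) ^ 2) := by
  have hcosh := (Real.cosh_pos y).ne'
  have hsinh : Real.sinh y = Real.tanh y * Real.cosh y := by
    rw [Real.tanh_eq_sinh_div_cosh, div_mul_cancel₀ _ hcosh]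
  have hsq : Real.cosh y ^ 2 * (1 - Real.tanh y ^ 2) = 1 := by
    linear_combination Real.cosh_sq_sub_sinh_sq y
      + (Real.sinh y + Real.tanh y * Real.cosh y) * hsinh
  have hden : (f ^ 2 + k ^ 4 * a ^ 2 + c ^ 2 * k ^ 2) * Real.cosh (2 * y)
      + 2 * c * k * f * Real.sinh (2 * y) + f ^ 2 + k ^ 4 * a ^ 2 - c ^ 2 * k ^ 2
      = 2 * Real.cosh y ^ 2 * (k ^ 4 * a ^ 2 + (f + c * k * Real.tanh y) ^ 2) := by
    rw [Real.cosh_two_mul, Real.sinh_two_mul, hsinh]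
    linear_combination (-(f ^ 2 + k ^ 4 * a ^ 2 - c ^ 2 * k ^ 2)) * hsq
  rw [hden, Real.cosh_two_mul, Real.sinh_two_mul, hsinh]
  field_simp
  ring

/-- The derivative of the potential along a curve on which the phase moves with
speed `c * τ`. -/
theorem hasDerivAt_potential_tanh {k c τ a' f' t : ℝ} {a f B : ℝ → ℝ}
    (ha : HasDerivAt a a' t) (hf : HasDerivAt f f' t) (hB : HasDerivAt B (c * τ) t)
    (hG : k ^ 4 * a t ^ 2 + (f t + c * k * Real.tanh (B t)) ^ 2 ≠ 0) :
    HasDerivAt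
      (fun s => 4 * c * Real.tanh (B s)
        + 4 * c ^ 2 * k * (1 - Real.tanh (B s) ^ 2) * (f s + c * k * Real.tanh (B s))
          / (k ^ 4 * a s ^ 2 + (f s + c * k * Real.tanh (B s)) ^ 2))
      (4 * c ^ 2 * (1 - Real.tanh (B t) ^ 2)
        * (τ - 2 * (c * k * Real.tanh (B t)) * τ * (f t + c * k * Real.tanh (B t))
              / (k ^ 4 * a t ^ 2 + (f t + c * k * Real.tanh (B t)) ^ 2)
          + ((k * f' + τ * (c ^ 2 * k ^ 2 * (1 - Real.tanh (B t) ^ 2)))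
                * (k ^ 4 * a t ^ 2 - (f t + c * k * Real.tanh (B t)) ^ 2)
              - 2 * k ^ 5 * a t * a' * (f t + c * k * Real.tanh (B t)))
            / (k ^ 4 * a t ^ 2 + (f t + c * k * Real.tanh (B t)) ^ 2) ^ 2)) t := by
  have hT : HasDerivAt (fun s => Real.tanh (B s))
      ((1 - Real.tanh (B t) ^ 2) * (c * τ)) t := (Real.hasDerivAt_tanh (B t)).comp t hB
  have hu := hf.fun_add (hT.const_mul (c * k))
  have hden := ((ha.fun_pow 2).const_mul (k ^ 4)).fun_add (hu.fun_pow 2)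
  have hnum := (((hT.fun_pow 2).const_sub 1).const_mul (4 * c ^ 2 * k)).fun_mul hu
  refine ((hT.const_mul (4 * c)).fun_add (hnum.fun_div hden hG)).congr_deriv ?_
  simp only [Nat.cast_ofNat, Nat.add_one_sub_one, pow_one]
  generalize hGdef : k ^ 4 * a t ^ 2 + (f t + c * k * Real.tanh (B t)) ^ 2 = G at hG ⊢
  field_simp
  rw [← hGdef]
  ring

/-- Proposition 2 (x-part): in the travelling-wave Bäcklund setup, the closed-form
expression for the associated potential `x` satisfies
`x_α = g[2δ(λ² + k cos w) + k(δ² − 1) sin w]/(2kλ(δ² + 1))` and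
`x_β = g[2δ(λ² − k cos w) − k(δ² − 1) sin w]/(2kλ(δ² + 1))`. -/
theorem associated_potential_x (k lam l K : ℝ) (hk : k ≠ 0) (hlam : lam ≠ 0)
    (w : ℝ → ℝ) (hw : Differentiable ℝ w) (hw' : Differentiable ℝ (deriv w))
    (hode : ∀ α : ℝ, k * deriv (deriv w) α = Real.sin (w α))
    (hfi : ∀ α : ℝ, k * (deriv w α) ^ 2 = 2 * l - 2 * Real.cos (w α))
    (hdisc : lam ^ 4 - 2 * k * l * lam ^ 2 + k ^ 2 > 0)
    (a f : ℝ → ℝ) (c : ℝ)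
    (ha : ∀ α : ℝ, a α = Real.sin (w α) / (4 * k * lam) - deriv w α / (4 * k))
    (hf : ∀ α : ℝ, f α = lam / 4 - k * Real.cos (w α) / (4 * lam))
    (hc : c = Real.sqrt (lam ^ 4 - 2 * k * l * lam ^ 2 + k ^ 2) / (4 * k * lam))
    (ha0 : ∀ α : ℝ, a α ≠ 0)
    (hne : ∀ α : ℝ, lam * deriv w α - Real.sin (w α) ≠ 0)
    (b : ℝ → ℝ) (hb : Differentiable ℝ b)
    (hb' : ∀ α : ℝ, deriv b α
      = (lam * deriv w α + Real.sin (w α)) / (lam * deriv w α - Real.sin (w α)))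
    (B : ℝ → ℝ → ℝ) (hB : ∀ α β : ℝ, B α β = c * (β + b α + K))
    (δ : ℝ → ℝ → ℝ)
    (hδ : ∀ α β : ℝ, δ α β
      = f α / (a α * k ^ 2) + (c / (a α * k)) * Real.tanh (B α β))
    (hgden : ∀ α β : ℝ,
      k ^ 4 * (a α) ^ 2 + (f α) ^ 2 + 2 * c * k * f α * Real.tanh (B α β)
        + c ^ 2 * k ^ 2 * (Real.tanh (B α β)) ^ 2 ≠ 0)
    (g : ℝ → ℝ → ℝ)
    (hg : ∀ α β : ℝ, g α β
      = 4 * c ^ 2 * k ^ 3 * a α * (1 - (Real.tanh (B α β)) ^ 2)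
        / (k ^ 4 * (a α) ^ 2 + (f α) ^ 2 + 2 * c * k * f α * Real.tanh (B α β)
            + c ^ 2 * k ^ 2 * (Real.tanh (B α β)) ^ 2))
    (hxden : ∀ α β : ℝ,
      ((f α) ^ 2 + k ^ 4 * (a α) ^ 2 + c ^ 2 * k ^ 2) * Real.cosh (2 * B α β)
        + 2 * c * k * f α * Real.sinh (2 * B α β)
        + (f α) ^ 2 + k ^ 4 * (a α) ^ 2 - c ^ 2 * k ^ 2 ≠ 0)
    (x : ℝ → ℝ → ℝ)
    (hx : ∀ α β : ℝ, x α β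
      = (8 * c ^ 2 * k * f α * Real.cosh (2 * B α β)
          + 4 * c * ((f α) ^ 2 + k ^ 4 * (a α) ^ 2 + c ^ 2 * k ^ 2)
              * Real.sinh (2 * B α β))
        / (((f α) ^ 2 + k ^ 4 * (a α) ^ 2 + c ^ 2 * k ^ 2) * Real.cosh (2 * B α β)
            + 2 * c * k * f α * Real.sinh (2 * B α β)
            + (f α) ^ 2 + k ^ 4 * (a α) ^ 2 - c ^ 2 * k ^ 2)) :
    ∀ α β : ℝ,
      pd1 x α β = g α β
        * (2 * δ α β * (lam ^ 2 + k * Real.cos (w α))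
            + k * ((δ α β) ^ 2 - 1) * Real.sin (w α))
        / (2 * k * lam * ((δ α β) ^ 2 + 1)) ∧
      pd2 x α β = g α β
        * (2 * δ α β * (lam ^ 2 - k * Real.cos (w α))
            - k * ((δ α β) ^ 2 - 1) * Real.sin (w α))
        / (2 * k * lam * ((δ α β) ^ 2 + 1)) := by
  intro α β
  obtain ⟨e, he⟩ : ∃ e, e = Real.sin (w α) / (4 * k * lam) + deriv w α / (4 * k) := ⟨_, rfl⟩
  have hS : Real.sin (w α) = 2 * k * lam * (a α + e) := by
    rw [ha, he]; field_simp; ring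
  have hP : deriv w α = 2 * k * (e - a α) := by
    rw [ha, he]; field_simp; ring
  have hC : Real.cos (w α) = (lam ^ 2 - 4 * lam * f α) / k := by
    rw [hf]; field_simp; ring
  have hc2 : c ^ 2 * k ^ 2 = f α ^ 2 + k ^ 4 * a α * e := by
    rw [hc, div_pow, Real.sq_sqrt hdisc.le, hf, ha, he]
    field_simp
    linear_combination (lam ^ 2 * k) * hfi α - k ^ 2 * Real.sin_sq_add_cos_sq (w α)
  have hτ : deriv b α = -e / a α := by
    have h := hne α
    have ha' := ha0 α
    rw [hb', div_eq_div_iff h ha', hS, hP]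
    ring
  have hw2 : deriv (deriv w) α = Real.sin (w α) / k := by
    rw [← hode α]; field_simp
  have hda : HasDerivAt a (-lam * a α / k - 2 * f α * (e - a α) / k) α := by
    have h := ((hw α).hasDerivAt.sin.div_const (4 * k * lam)).fun_sub
      ((hw' α).hasDerivAt.div_const (4 * k))
    refine (h.congr_deriv ?_).congr_of_eventuallyEq (.of_forall ha)
    rw [hw2, hS, hC, hP]
    field_simp
    ring
  have hdf : HasDerivAt f (k ^ 3 * (e ^ 2 - a α ^ 2)) α := by
    have h := (((hw α).hasDerivAt.cos.const_mul k).div_const (4 * lam)).const_sub (lam / 4)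
    refine (h.congr_deriv ?_).congr_of_eventuallyEq (.of_forall hf)
    rw [hS, hP]
    field_simp
    ring
  have hdB1 : HasDerivAt (fun s => B s β) (c * (-e / a α)) α := by
    rw [show (fun s => B s β) = _ from funext fun s => hB s β, ← hτ]
    exact (((hb α).hasDerivAt.const_add β).add_const K).const_mul c
  have hdB2 : HasDerivAt (fun s => B α s) (c * 1) β := by
    rw [show (fun s => B α s) = _ from funext fun s => hB α s]
    exact (((hasDerivAt_id β).add_const (b α)).add_const K).const_mul c
  have hG : ∀ s r, k ^ 4 * a s ^ 2 + (f s + c * k * Real.tanh (B s r)) ^ 2 ≠ 0 := by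
    intro s r h
    exact hgden s r (by linear_combination h)
  have hx' : ∀ s r, x s r = _ := fun s r =>
    (hx s r).trans (potential_eq_tanh k c (a s) (f s) (B s r) (hG s r))
  have hd1 := hasDerivAt_potential_tanh hda hdf hdB1 (hG α β)
  have hd2 := hasDerivAt_potential_tanh (hasDerivAt_const β (a α)) (hasDerivAt_const β (f α))
    hdB2 (hG α β)
  unfold pd1 pd2
  rw [show (fun s => x s β) = _ from funext fun s => hx' s β, hd1.deriv,
    show (fun r => x α r) = _ from funext fun r => hx' α r, hd2.deriv]
  have hGα := hG α β
  have hA := ha0 α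
  have hgu : g α β = 4 * c ^ 2 * k ^ 3 * a α * (1 - Real.tanh (B α β) ^ 2)
      / (k ^ 4 * a α ^ 2 + (f α + c * k * Real.tanh (B α β)) ^ 2) := by
    rw [hg]; congr 1; ring
  have hδu : δ α β = (f α + c * k * Real.tanh (B α β)) / (a α * k ^ 2) := by
    rw [hδ]; field_simp
  obtain ⟨u, hu⟩ : ∃ u, u = f α + c * k * Real.tanh (B α β) := ⟨_, rfl⟩
  have hckT : c * k * Real.tanh (B α β) = u - f α := by rw [hu]; ring
  have hT2 : c ^ 2 * k ^ 2 * (1 - Real.tanh (B α β) ^ 2)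
      = k ^ 4 * a α * e - u ^ 2 + 2 * u * f α := by
    rw [hu]; linear_combination hc2
  rw [← hu] at hGα
  have hδ1 : δ α β ^ 2 + 1 = (k ^ 4 * a α ^ 2 + u ^ 2) / (a α * k ^ 2) ^ 2 := by
    rw [hδu, ← hu]; field_simp; ring
  rw [hδ1, hgu, hδu, hT2, ← hu, hckT, hS, hC]
  constructor
  · field_simp
    ring
  · field_simp
    ring
end

section
/- (Proposition 2, y-part.) In the travelling-wave Bäcklund setup with b'(α) = (λ w' + sin w)/(λ w' − sin w), K ∈ ℝ, B(α,β) = c(β + b(α) + K), δ = f/(ak²) + (c/(ak)) tanh B, and g = 4c²k³a(1 − tanh² B)/(k⁴a² + f² + 2ckf tanh B + c²k² tanh² B), let G : ℝ → ℝ be an antiderivative of α ↦ cos w(α), and define y(α,β) := ( f sin w/(16λc²k²a) − (2f − λ)/(8c²k) ) cosh 2B − ( (k⁴a² − c²k² − f²) sin w/(32λc³k³a) + f(2f − λ)/(8c³k²) ) sinh 2B + ( (λ⁴ − k²)β/2 + (λ⁴ + k²)α/2 − kλ² G(α) ) / (λ⁴ − 2klλ² + k²), with w, a, f evaluated at α and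 all denominators assumed nonvanishing. Then y satisfies y_α = (1/g) · [ 2δ(λ² − k cos w) − k(δ² − 1) sin w ] / (2kλ(δ² + 1)) and y_β = (1/g) · [ 2δ(λ² + k cos w) + k(δ² − 1) sin w ] / (2kλ(δ² + 1)). -/
/-- The coefficient of `cosh 2B` in the associated potential. -/
noncomputable def coshCoeff (k lam c a f S : ℝ) : ℝ :=
  f * S / (16 * lam * c ^ 2 * k ^ 2 * a) - (2 * f - lam) / (8 * c ^ 2 * k)

/-- The coefficient of `-sinh 2B` in the associated potential. -/
noncomputable def sinhCoeff (k lam c a f S : ℝ) : ℝ :=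
  (k ^ 4 * a ^ 2 - c ^ 2 * k ^ 2 - f ^ 2) * S / (32 * lam * c ^ 3 * k ^ 3 * a)
    + f * (2 * f - lam) / (8 * c ^ 3 * k ^ 2)

/-- The derivative of `coshCoeff`, given the derivatives of `a`, `f` and `S`. -/
noncomputable def coshCoeffDeriv (k lam c a f S a' f' S' : ℝ) : ℝ :=
  (f' * S * a + f * S' * a - f * S * a') / (16 * lam * c ^ 2 * k ^ 2 * a ^ 2)
    - 2 * f' / (8 * c ^ 2 * k)

/-- The derivative of `sinhCoeff`, given the derivatives of `a`, `f` and `S`. -/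
noncomputable def sinhCoeffDeriv (k lam c a f S a' f' S' : ℝ) : ℝ :=
  ((k ^ 4 * (2 * a * a') - 2 * f * f') * S * a
      + (k ^ 4 * a ^ 2 - c ^ 2 * k ^ 2 - f ^ 2) * (S' * a - S * a'))
      / (32 * lam * c ^ 3 * k ^ 3 * a ^ 2)
    + (f' * (2 * f - lam) + f * (2 * f')) / (8 * c ^ 3 * k ^ 2)

theorem HasDerivAt.coshCoeff {k lam c x a' f' S' : ℝ} {a f S : ℝ → ℝ}
    (hk : k ≠ 0) (hlam : lam ≠ 0) (hc : c ≠ 0) (h0 : a x ≠ 0)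
    (ha : HasDerivAt a a' x) (hf : HasDerivAt f f' x) (hS : HasDerivAt S S' x) :
    HasDerivAt (fun t => coshCoeff k lam c (a t) (f t) (S t))
      (coshCoeffDeriv k lam c (a x) (f x) (S x) a' f' S') x := by
  have h := ((hf.fun_mul hS).fun_div (ha.const_mul (16 * lam * c ^ 2 * k ^ 2))
    (by positivity)).fun_sub (((hf.const_mul 2).sub_const lam).div_const (8 * c ^ 2 * k))
  refine h.congr_deriv ?_
  unfold coshCoeffDeriv
  field_simp

theorem HasDerivAt.sinhCoeff {k lam c x a' f' S' : ℝ} {a f S : ℝ → ℝ}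
    (hk : k ≠ 0) (hlam : lam ≠ 0) (hc : c ≠ 0) (h0 : a x ≠ 0)
    (ha : HasDerivAt a a' x) (hf : HasDerivAt f f' x) (hS : HasDerivAt S S' x) :
    HasDerivAt (fun t => sinhCoeff k lam c (a t) (f t) (S t))
      (sinhCoeffDeriv k lam c (a x) (f x) (S x) a' f' S') x := by
  have h := ((((((ha.fun_pow 2).const_mul (k ^ 4)).sub_const (c ^ 2 * k ^ 2)).fun_sub
    (hf.fun_pow 2)).fun_mul hS).fun_div (ha.const_mul (32 * lam * c ^ 3 * k ^ 3))
    (by positivity)).fun_add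
    ((hf.fun_mul ((hf.const_mul 2).sub_const lam)).div_const (8 * c ^ 3 * k ^ 2))
  refine h.congr_deriv ?_
  unfold sinhCoeffDeriv
  field_simp
  push_cast
  ring

section Algebra

variable {k lam a f S c C p h s : ℝ}

theorem beta_deriv_identity (hk : k ≠ 0) (hlam : lam ≠ 0) (ha : a ≠ 0) (hc : c ≠ 0)
    (hC : C = (lam ^ 2 - 4 * lam * f) / k)
    (hcc : 2 * lam * c ^ 2 * k ^ 2 = 2 * lam * f ^ 2 - 2 * lam * k ^ 4 * a ^ 2 + k ^ 3 * S * a)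
    (hSS : k ^ 2 * S ^ 2 = k ^ 2 - (lam ^ 2 - 4 * lam * f) ^ 2) (hs : h ^ 2 = 1 + s ^ 2) :
    coshCoeff k lam c a f S * (2 * s * h * (2 * c))
        - sinhCoeff k lam c a f S * ((h ^ 2 + s ^ 2) * (2 * c))
        + (lam ^ 4 - k ^ 2) / 2 / (16 * k ^ 2 * lam ^ 2 * c ^ 2)
      = (2 * a * k ^ 2 * h * (f * h + c * k * s) * (lam ^ 2 + k * C)
          + k * ((f * h + c * k * s) ^ 2 - a ^ 2 * k ^ 4 * h ^ 2) * S)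
        / (8 * c ^ 2 * lam * a * k ^ 4) := by
  subst hC
  unfold coshCoeff sinhCoeff
  field_simp
  grind

theorem alpha_deriv_cosh_identity (hk : k ≠ 0) (hlam : lam ≠ 0) (ha : a ≠ 0) (hc : c ≠ 0)
    (hC : C = (lam ^ 2 - 4 * lam * f) / k) (hp : p = S / lam - 4 * k * a)
    (hcc : 2 * lam * c ^ 2 * k ^ 2 = 2 * lam * f ^ 2 - 2 * lam * k ^ 4 * a ^ 2 + k ^ 3 * S * a) :
    coshCoeffDeriv k lam c a f S (C * p / (4 * k * lam) - S / (4 * k ^ 2))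
          (k * S * p / (4 * lam)) (C * p)
        - 2 * c * (1 - S / (2 * k * lam * a)) * sinhCoeff k lam c a f S
      = (2 * a * k ^ 2 * f * (lam ^ 2 - k * C)
          - k * (f ^ 2 + c ^ 2 * k ^ 2 - a ^ 2 * k ^ 4) * S) / 2
        / (8 * c ^ 2 * lam * a * k ^ 4) := by
  subst hp hC
  unfold coshCoeffDeriv sinhCoeff
  field_simp
  clear hk hlam ha hc
  grind

theorem alpha_deriv_sinh_identity (hk : k ≠ 0) (hlam : lam ≠ 0) (ha : a ≠ 0) (hc : c ≠ 0)
    (hC : C = (lam ^ 2 - 4 * lam * f) / k) (hp : p = S / lam - 4 * k * a)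
    (hcc : 2 * lam * c ^ 2 * k ^ 2 = 2 * lam * f ^ 2 - 2 * lam * k ^ 4 * a ^ 2 + k ^ 3 * S * a) :
    2 * c * (1 - S / (2 * k * lam * a)) * coshCoeff k lam c a f S
        - sinhCoeffDeriv k lam c a f S (C * p / (4 * k * lam) - S / (4 * k ^ 2))
          (k * S * p / (4 * lam)) (C * p)
      = (a * k ^ 3 * c * (lam ^ 2 - k * C) - f * c * k ^ 2 * S)
        / (8 * c ^ 2 * lam * a * k ^ 4) := by
  subst hp hC
  unfold sinhCoeffDeriv coshCoeff
  field_simp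
  clear hk hlam ha hc
  grind

theorem alpha_deriv_const_identity (hk : k ≠ 0) (hlam : lam ≠ 0) (ha : a ≠ 0) (hc : c ≠ 0)
    (hC : C = (lam ^ 2 - 4 * lam * f) / k)
    (hcc : 2 * lam * c ^ 2 * k ^ 2 = 2 * lam * f ^ 2 - 2 * lam * k ^ 4 * a ^ 2 + k ^ 3 * S * a)
    (hSS : k ^ 2 * S ^ 2 = k ^ 2 - (lam ^ 2 - 4 * lam * f) ^ 2) :
    ((lam ^ 4 + k ^ 2) / 2 - k * lam ^ 2 * C) / (16 * k ^ 2 * lam ^ 2 * c ^ 2)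
      = (2 * a * k ^ 2 * f * (lam ^ 2 - k * C)
          - k * (f ^ 2 - c ^ 2 * k ^ 2 - a ^ 2 * k ^ 4) * S) / 2
        / (8 * c ^ 2 * lam * a * k ^ 4) := by
  subst hC
  field_simp
  clear hk hlam ha hc
  grind

theorem alpha_deriv_identity (hk : k ≠ 0) (hlam : lam ≠ 0) (ha : a ≠ 0) (hc : c ≠ 0)
    (hC : C = (lam ^ 2 - 4 * lam * f) / k) (hp : p = S / lam - 4 * k * a)
    (hcc : 2 * lam * c ^ 2 * k ^ 2 = 2 * lam * f ^ 2 - 2 * lam * k ^ 4 * a ^ 2 + k ^ 3 * S * a)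
    (hSS : k ^ 2 * S ^ 2 = k ^ 2 - (lam ^ 2 - 4 * lam * f) ^ 2) (hs : h ^ 2 = 1 + s ^ 2) :
    coshCoeffDeriv k lam c a f S (C * p / (4 * k * lam) - S / (4 * k ^ 2))
          (k * S * p / (4 * lam)) (C * p) * (h ^ 2 + s ^ 2)
        + coshCoeff k lam c a f S
          * (2 * s * h * (2 * (c * (1 - S / (2 * k * lam * a)))))
        - (sinhCoeffDeriv k lam c a f S (C * p / (4 * k * lam) - S / (4 * k ^ 2))
            (k * S * p / (4 * lam)) (C * p) * (2 * s * h)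
          + sinhCoeff k lam c a f S
            * ((h ^ 2 + s ^ 2) * (2 * (c * (1 - S / (2 * k * lam * a))))))
        + ((lam ^ 4 + k ^ 2) / 2 - k * lam ^ 2 * C) / (16 * k ^ 2 * lam ^ 2 * c ^ 2)
      = (2 * a * k ^ 2 * h * (f * h + c * k * s) * (lam ^ 2 - k * C)
          - k * ((f * h + c * k * s) ^ 2 - a ^ 2 * k ^ 4 * h ^ 2) * S)
        / (8 * c ^ 2 * lam * a * k ^ 4) := by
  linear_combination (h ^ 2 + s ^ 2) * alpha_deriv_cosh_identity hk hlam ha hc hC hp hcc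
    + 2 * s * h * alpha_deriv_sinh_identity hk hlam ha hc hC hp hcc
    + alpha_deriv_const_identity hk hlam ha hc hC hcc hSS
    - (2 * a * k ^ 2 * f * (lam ^ 2 - k * C)
          - k * (f ^ 2 - c ^ 2 * k ^ 2 - a ^ 2 * k ^ 4) * S) / 2
        / (8 * c ^ 2 * lam * a * k ^ 4) * hs

/-- The right-hand sides of the equations for the associated potential with `tanh = s / h`
cleared of denominators; `μ` stands for `λ² ± k cos w` and `ν` for `± k sin w`. -/
theorem rhs_identity {δ g : ℝ} (μ ν : ℝ) (hk : k ≠ 0) (hlam : lam ≠ 0) (ha : a ≠ 0)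
    (hc : c ≠ 0) (hs : h ^ 2 = 1 + s ^ 2) (hh : h ≠ 0)
    (hδ : δ = f / (a * k ^ 2) + c / (a * k) * (s / h))
    (hg : g = 4 * c ^ 2 * k ^ 3 * a * (1 - (s / h) ^ 2)
      / (k ^ 4 * a ^ 2 + f ^ 2 + 2 * c * k * f * (s / h) + c ^ 2 * k ^ 2 * (s / h) ^ 2)) :
    (1 / g) * (2 * δ * μ + (δ ^ 2 - 1) * ν) / (2 * k * lam * (δ ^ 2 + 1))
      = (2 * a * k ^ 2 * h * (f * h + c * k * s) * μ
          + ((f * h + c * k * s) ^ 2 - a ^ 2 * k ^ 4 * h ^ 2) * ν)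
        / (8 * c ^ 2 * lam * a * k ^ 4) := by
  obtain ⟨N, hN⟩ : ∃ N, N = f * h + c * k * s := ⟨_, rfl⟩
  have hM : k ^ 4 * a ^ 2 * h ^ 2 + N ^ 2 ≠ 0 := by positivity
  have hδ' : δ = N / (a * k ^ 2 * h) := by rw [hδ, hN]; field_simp
  have hg' : g = 4 * c ^ 2 * k ^ 3 * a / (k ^ 4 * a ^ 2 * h ^ 2 + N ^ 2) := by
    have h1 : 1 - (s / h) ^ 2 = 1 / h ^ 2 := by
      field_simp
      linear_combination hs
    have h2 : k ^ 4 * a ^ 2 + f ^ 2 + 2 * c * k * f * (s / h) + c ^ 2 * k ^ 2 * (s / h) ^ 2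
        = (k ^ 4 * a ^ 2 * h ^ 2 + N ^ 2) / h ^ 2 := by
      rw [hN]
      field_simp
      ring
    rw [hg, h1, h2]
    field_simp
  have hδ1 : δ ^ 2 + 1 = (k ^ 4 * a ^ 2 * h ^ 2 + N ^ 2) / (a * k ^ 2 * h) ^ 2 := by
    rw [hδ']
    field_simp
    ring
  rw [hδ1, hδ', hg', ← hN]
  field_simp
  ring

end Algebra

/-- Proposition 2 (y-part): in the travelling-wave Bäcklund setup, the closed-form
expression for the associated potential `y` satisfies
`y_α = (1/g)[2δ(λ² − k cos w) − k(δ² − 1) sin w]/(2kλ(δ² + 1))` and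
`y_β = (1/g)[2δ(λ² + k cos w) + k(δ² − 1) sin w]/(2kλ(δ² + 1))`. -/
theorem associated_potential_y (k lam l K : ℝ) (hk : k ≠ 0) (hlam : lam ≠ 0)
    (w : ℝ → ℝ) (hw : Differentiable ℝ w) (hw' : Differentiable ℝ (deriv w))
    (hode : ∀ α : ℝ, k * deriv (deriv w) α = Real.sin (w α))
    (hfi : ∀ α : ℝ, k * (deriv w α) ^ 2 = 2 * l - 2 * Real.cos (w α))
    (hdisc : lam ^ 4 - 2 * k * l * lam ^ 2 + k ^ 2 > 0)
    (a f : ℝ → ℝ) (c : ℝ)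
    (ha : ∀ α : ℝ, a α = Real.sin (w α) / (4 * k * lam) - deriv w α / (4 * k))
    (hf : ∀ α : ℝ, f α = lam / 4 - k * Real.cos (w α) / (4 * lam))
    (hc : c = Real.sqrt (lam ^ 4 - 2 * k * l * lam ^ 2 + k ^ 2) / (4 * k * lam))
    (ha0 : ∀ α : ℝ, a α ≠ 0)
    (hne : ∀ α : ℝ, lam * deriv w α - Real.sin (w α) ≠ 0)
    (b : ℝ → ℝ) (hb : Differentiable ℝ b)
    (hb' : ∀ α : ℝ, deriv b α
      = (lam * deriv w α + Real.sin (w α)) / (lam * deriv w α - Real.sin (w α)))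
    (B : ℝ → ℝ → ℝ) (hB : ∀ α β : ℝ, B α β = c * (β + b α + K))
    (δ : ℝ → ℝ → ℝ)
    (hδ : ∀ α β : ℝ, δ α β
      = f α / (a α * k ^ 2) + (c / (a α * k)) * Real.tanh (B α β))
    (hgden : ∀ α β : ℝ,
      k ^ 4 * (a α) ^ 2 + (f α) ^ 2 + 2 * c * k * f α * Real.tanh (B α β)
        + c ^ 2 * k ^ 2 * (Real.tanh (B α β)) ^ 2 ≠ 0)
    (g : ℝ → ℝ → ℝ)
    (hg : ∀ α β : ℝ, g α β
      = 4 * c ^ 2 * k ^ 3 * a α * (1 - (Real.tanh (B α β)) ^ 2)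
        / (k ^ 4 * (a α) ^ 2 + (f α) ^ 2 + 2 * c * k * f α * Real.tanh (B α β)
            + c ^ 2 * k ^ 2 * (Real.tanh (B α β)) ^ 2))
    (hg0 : ∀ α β : ℝ, g α β ≠ 0)
    (G : ℝ → ℝ) (hG : ∀ α : ℝ, HasDerivAt G (Real.cos (w α)) α)
    (y : ℝ → ℝ → ℝ)
    (hy : ∀ α β : ℝ, y α β
      = (f α * Real.sin (w α) / (16 * lam * c ^ 2 * k ^ 2 * a α)
          - (2 * f α - lam) / (8 * c ^ 2 * k)) * Real.cosh (2 * B α β)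
        - ((k ^ 4 * (a α) ^ 2 - c ^ 2 * k ^ 2 - (f α) ^ 2) * Real.sin (w α)
              / (32 * lam * c ^ 3 * k ^ 3 * a α)
            + f α * (2 * f α - lam) / (8 * c ^ 3 * k ^ 2)) * Real.sinh (2 * B α β)
        + ((lam ^ 4 - k ^ 2) / 2 * β + (lam ^ 4 + k ^ 2) / 2 * α
            - k * lam ^ 2 * G α)
          / (lam ^ 4 - 2 * k * l * lam ^ 2 + k ^ 2)) :
    ∀ α β : ℝ,
      pd1 y α β = (1 / g α β)
        * (2 * δ α β * (lam ^ 2 - k * Real.cos (w α))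
            - k * ((δ α β) ^ 2 - 1) * Real.sin (w α))
        / (2 * k * lam * ((δ α β) ^ 2 + 1)) ∧
      pd2 y α β = (1 / g α β)
        * (2 * δ α β * (lam ^ 2 + k * Real.cos (w α))
            + k * ((δ α β) ^ 2 - 1) * Real.sin (w α))
        / (2 * k * lam * ((δ α β) ^ 2 + 1)) := by
  intro α β
  have hc0 : c ≠ 0 := by
    rw [hc]
    have := Real.sqrt_pos.mpr hdisc
    positivity
  have hD : lam ^ 4 - 2 * k * l * lam ^ 2 + k ^ 2 = 16 * k ^ 2 * lam ^ 2 * c ^ 2 := by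
    rw [hc, div_pow, Real.sq_sqrt hdisc.le]
    field_simp
    ring
  have hC : Real.cos (w α) = (lam ^ 2 - 4 * lam * f α) / k := by
    rw [hf]
    field_simp
    ring
  have hp : deriv w α = Real.sin (w α) / lam - 4 * k * a α := by
    rw [ha]
    field_simp
    ring
  have hSS : k ^ 2 * Real.sin (w α) ^ 2 = k ^ 2 - (lam ^ 2 - 4 * lam * f α) ^ 2 := by
    have h1 : lam ^ 2 - 4 * lam * f α = k * Real.cos (w α) := by
      rw [hC]
      field_simp
    rw [h1]
    linear_combination k ^ 2 * Real.sin_sq_add_cos_sq (w α)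
  have hcc : 2 * lam * c ^ 2 * k ^ 2
      = 2 * lam * f α ^ 2 - 2 * lam * k ^ 4 * a α ^ 2 + k ^ 3 * Real.sin (w α) * a α := by
    have h1 : 8 * lam * (2 * lam * c ^ 2 * k ^ 2) = lam ^ 4 - 2 * k * l * lam ^ 2 + k ^ 2 := by
      linear_combination -hD
    have h2 := hfi α
    have h3 : 4 * lam * f α = lam ^ 2 - k * Real.cos (w α) := by
      rw [hf]
      field_simp
    have h4 : 4 * k * lam * a α = Real.sin (w α) - lam * deriv w α := by
      rw [ha]
      field_simp
    have h5 := Real.sin_sq_add_cos_sq (w α)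
    have h6 : (8 * lam) ≠ 0 := by positivity
    apply mul_left_cancel₀ h6
    rw [h1]
    linear_combination (k * lam ^ 2) * h2 - (4 * lam * f α + lam ^ 2 - k * Real.cos (w α)) * h3
      + (k ^ 2 * (4 * k * lam * a α + Real.sin (w α) - lam * deriv w α)
        - 2 * k ^ 2 * Real.sin (w α)) * h4 - k ^ 2 * h5
  have hb1 : deriv b α = 1 - Real.sin (w α) / (2 * k * lam * a α) := by
    have h1 : lam * deriv w α - Real.sin (w α) = -(4 * k * lam * a α) := by
      rw [hp]
      field_simp
      ring
    have := ha0 α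
    rw [hb', h1, hp]
    field_simp
    ring
  have hw1 := (hw α).hasDerivAt
  have hw2 : HasDerivAt (deriv w) (Real.sin (w α) / k) α :=
    (hw' α).hasDerivAt.congr_deriv (by rw [← hode]; field_simp)
  have hda : HasDerivAt a (Real.cos (w α) * deriv w α / (4 * k * lam)
      - Real.sin (w α) / (4 * k ^ 2)) α := by
    rw [funext ha]
    exact ((hw1.sin.div_const _).fun_sub (hw2.div_const _)).congr_deriv (by field_simp)
  have hdf : HasDerivAt f (k * Real.sin (w α) * deriv w α / (4 * lam)) α := by
    rw [funext hf]
    exact (((hw1.cos.const_mul k).div_const _).const_sub _).congr_deriv (by ring)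
  have hs := Real.cosh_sq' (B α β)
  have hh : Real.cosh (B α β) ≠ 0 := (Real.cosh_pos _).ne'
  have hδ' := hδ α β
  have hg' := hg α β
  rw [Real.tanh_eq_sinh_div_cosh] at hδ' hg'
  constructor
  · have hBd : HasDerivAt (fun t => 2 * B t β)
        (2 * (c * (1 - Real.sin (w α) / (2 * k * lam * a α)))) α := by
      simp only [hB]
      rw [← hb1]
      exact ((((hb α).hasDerivAt.const_add β).add_const K).const_mul c).const_mul 2
    have hyd := (((hda.coshCoeff hk hlam hc0 (ha0 α) hdf hw1.sin).fun_mul hBd.cosh).fun_sub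
      ((hda.sinhCoeff hk hlam hc0 (ha0 α) hdf hw1.sin).fun_mul hBd.sinh)).fun_add
      (((((hasDerivAt_id' α).const_mul ((lam ^ 4 + k ^ 2) / 2)).const_add
        ((lam ^ 4 - k ^ 2) / 2 * β)).fun_sub ((hG α).const_mul (k * lam ^ 2))).div_const
        (lam ^ 4 - 2 * k * l * lam ^ 2 + k ^ 2))
    have hy' : (fun t => y t β) = _ := funext fun t => hy t β
    rw [pd1, hy']
    refine hyd.deriv.trans ?_
    rw [Real.cosh_two_mul, Real.sinh_two_mul, hD, mul_one,
      alpha_deriv_identity hk hlam (ha0 α) hc0 hC hp hcc hSS hs]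
    have := rhs_identity (lam ^ 2 - k * Real.cos (w α)) (-(k * Real.sin (w α)))
      hk hlam (ha0 α) hc0 hs hh hδ' hg'
    convert this.symm using 2 <;> ring
  · have hBd : HasDerivAt (fun t => 2 * B α t) (2 * c) β := by
      simp only [hB]
      exact (((((hasDerivAt_id' β).add_const (b α)).add_const K).const_mul c).const_mul
        2).congr_deriv (by ring)
    have hyd := ((hBd.cosh.const_mul (coshCoeff k lam c (a α) (f α) (Real.sin (w α)))).fun_sub
      (hBd.sinh.const_mul (sinhCoeff k lam c (a α) (f α) (Real.sin (w α))))).fun_add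
      (((((hasDerivAt_id' β).const_mul ((lam ^ 4 - k ^ 2) / 2)).add_const
        ((lam ^ 4 + k ^ 2) / 2 * α)).sub_const (k * lam ^ 2 * G α)).div_const
        (lam ^ 4 - 2 * k * l * lam ^ 2 + k ^ 2))
    have hy' : (fun t => y α t) = _ := funext fun t => hy α t
    rw [pd2, hy']
    refine hyd.deriv.trans ?_
    rw [Real.cosh_two_mul, Real.sinh_two_mul, hD, mul_one,
      beta_deriv_identity hk hlam (ha0 α) hc0 hC hcc hSS hs]
    have := rhs_identity (lam ^ 2 + k * Real.cos (w α)) (k * Real.sin (w α))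
      hk hlam (ha0 α) hc0 hs hh hδ' hg'
    convert this.symm using 2 <;> ring
end
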